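/- arXiv:2001.00512 — 2 statements merged into one kernel-verified Lean document; each statement's English description precedes it below -/
import Mathlib

section
/- Let X be a Banach space, p ∈ (1,∞), κ ∈ (−1, p−1), C ≥ 0 and T > 0. Let f' : (0,T) → X be strongly measurable with ‖f'‖_{L^p((0,T),w_κ;X)} < ∞, and set f(t) := ∫_0^t f'(s) ds for t ∈ [0,T] (so f(0) = 0). Suppose h : ℝ → X is strongly measurable and satisfies ‖h‖_{L^p(ℝ,w_κ;X)} ≤ C ( ‖s ↦ f(Ts)‖_{L^p((0,1),w_κ;X)} + ‖s ↦ T f'(Ts)‖_{L^p((0,1),w_κ;X)} ). Then ‖t ↦ T^{−1} h(t/T)‖_{L^p(ℝ,w_κ;X)} ≤ C (1 + C_{p,κ}) ‖f'‖_{L^p((0,T),w_κ;X)}, where C_{p,κ} is any constant (depending only on p and κ) for which the weighted Poincaré inequality ‖f‖_{L^p((0,T),w_κ;X)} ≤ C_{p,κ} T ‖f'‖_{L^p((0,T),w_κ;X)} holds; such a constant exists. In particular the resulting bound is independent of T. -/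
open MeasureTheory Set
open scoped ENNReal NNReal

/-- The weighted norm `‖f‖_{L^p(I,w_κ;X)} = (∫_I ‖f(t)‖^p |t|^κ dt)^{1/p}` (as an extended real
number), where `w_κ(t) = |t|^κ`. -/
noncomputable def weightedNorm {X : Type*} [NormedAddCommGroup X]
    (p κ : ℝ) (I : Set ℝ) (f : ℝ → X) : ℝ≥0∞ :=
  (∫⁻ t in I, ENNReal.ofReal (‖f t‖ ^ p * |t| ^ κ)) ^ (1 / p)

/-- Scaling of the weighted norm under a dilation of the variable. -/
lemma weightedNorm_comp_mul_left {X : Type*} [NormedAddCommGroup X] {p κ c : ℝ} (hp : 0 < p)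
    (hc : 0 < c) (I : Set ℝ) (f : ℝ → X) :
    weightedNorm p κ ((c * ·) ⁻¹' I) (fun t => f (c * t)) =
      ENNReal.ofReal (c ^ (-(κ + 1) / p)) * weightedNorm p κ I f := by
  have hemb : MeasurableEmbedding (c * · : ℝ → ℝ) :=
    (Homeomorph.mulLeft₀ c hc.ne').measurableEmbedding
  have hmap : ∫⁻ t in I, ENNReal.ofReal (‖f t‖ ^ p * |t| ^ κ) =
      ENNReal.ofReal c *
        ∫⁻ t in (c * ·) ⁻¹' I, ENNReal.ofReal (‖f (c * t)‖ ^ p * |c * t| ^ κ) := by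
    conv_lhs => rw [← Real.smul_map_volume_mul_left hc.ne']
    rw [Measure.restrict_smul, lintegral_smul_measure, hemb.restrict_map, hemb.lintegral_map,
      abs_of_pos hc, smul_eq_mul]
  have hpull (t : ℝ) : ENNReal.ofReal (‖f (c * t)‖ ^ p * |c * t| ^ κ) =
      ENNReal.ofReal (c ^ κ) * ENNReal.ofReal (‖f (c * t)‖ ^ p * |t| ^ κ) := by
    rw [← ENNReal.ofReal_mul (by positivity), abs_mul, abs_of_pos hc,
      Real.mul_rpow hc.le (abs_nonneg t)]
    ring_nf
  simp_rw [hpull] at hmap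
  rw [lintegral_const_mul' _ _ ENNReal.ofReal_ne_top, ← mul_assoc,
    ← ENNReal.ofReal_mul hc.le] at hmap
  unfold weightedNorm
  rw [hmap, ENNReal.mul_rpow_of_nonneg _ _ (by positivity : 0 ≤ 1 / p), ← mul_assoc,
    ENNReal.ofReal_rpow_of_nonneg (by positivity) (by positivity),
    ← ENNReal.ofReal_mul (by positivity)]
  have hone : c ^ (-(κ + 1) / p) * (c * c ^ κ) ^ (1 / p) = 1 := by
    rw [mul_comm c, ← Real.rpow_add_one hc.ne', ← Real.rpow_mul hc.le, ← Real.rpow_add hc,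
      mul_one_div, ← add_div, neg_add_cancel, zero_div, Real.rpow_zero]
  rw [hone, ENNReal.ofReal_one, one_mul]

lemma weightedNorm_const_smul {X : Type*} [NormedAddCommGroup X] [NormedSpace ℝ X] {p κ c : ℝ}
    (hp : 0 < p) (hc : 0 ≤ c) (I : Set ℝ) (f : ℝ → X) :
    weightedNorm p κ I (fun t => c • f t) = ENNReal.ofReal c * weightedNorm p κ I f := by
  have hpull (t : ℝ) : ENNReal.ofReal (‖c • f t‖ ^ p * |t| ^ κ) =
      ENNReal.ofReal (c ^ p) * ENNReal.ofReal (‖f t‖ ^ p * |t| ^ κ) := by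
    rw [← ENNReal.ofReal_mul (by positivity), norm_smul, Real.norm_of_nonneg hc,
      Real.mul_rpow hc (norm_nonneg _), mul_assoc]
  unfold weightedNorm
  simp_rw [hpull]
  rw [lintegral_const_mul' _ _ ENNReal.ofReal_ne_top,
    ENNReal.mul_rpow_of_nonneg _ _ (by positivity : 0 ≤ 1 / p),
    ENNReal.ofReal_rpow_of_nonneg (by positivity) (by positivity), ← Real.rpow_mul hc,
    mul_one_div_cancel hp.ne', Real.rpow_one]

lemma lintegral_Ioo_rpow_neg {a t : ℝ} (ha : a < 1) (ht : 0 < t) :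
    ∫⁻ s in Ioo 0 t, ENNReal.ofReal (s ^ (-a)) = ENNReal.ofReal (t ^ (1 - a) / (1 - a)) := by
  have hi : IntervalIntegrable (fun s : ℝ => s ^ (-a)) volume 0 t :=
    intervalIntegral.intervalIntegrable_rpow' (by linarith)
  rw [intervalIntegrable_iff_integrableOn_Ioo_of_le ht.le] at hi
  rw [← ofReal_integral_eq_lintegral_ofReal hi
      ((ae_restrict_iff' measurableSet_Ioo).2 (.of_forall fun s hs => Real.rpow_nonneg hs.1.le _)),
    ← integral_Ioc_eq_integral_Ioo, ← intervalIntegral.integral_of_le ht.le,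
    integral_rpow (Or.inl (by linarith)), Real.zero_rpow (by linarith), sub_zero, neg_add_eq_sub]

/-- Hölder's inequality bounds the primitive of `g` by the weighted norm of `g`. -/
lemma enorm_integral_Ioo_le_weightedNorm {X : Type*} [NormedAddCommGroup X] [NormedSpace ℝ X]
    {p κ T t : ℝ} (hp : 1 < p) (hκ : κ < p - 1) {g : ℝ → X}
    (hg : AEStronglyMeasurable g (volume.restrict (Ioo 0 T))) (ht : t ∈ Ioo 0 T) :
    ‖∫ s in Ioo 0 t, g s‖ₑ ≤ weightedNorm p κ (Ioo 0 T) g *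
      ENNReal.ofReal ((t ^ (1 - κ / (p - 1)) / (1 - κ / (p - 1))) ^ ((p - 1) / p)) := by
  have hp0 : 0 < p := by linarith
  have hp1 : 0 < p - 1 := by linarith
  have ha : κ / (p - 1) < 1 := by rwa [div_lt_one hp1]
  have hsub : Ioo 0 t ⊆ Ioo 0 T := Ioo_subset_Ioo_right ht.2.le
  have hpq : p.HolderConjugate (p / (p - 1)) := .conjExponent hp
  have hgt := hg.mono_measure (Measure.restrict_mono_set volume hsub)
  calc ‖∫ s in Ioo 0 t, g s‖ₑ ≤ ∫⁻ s in Ioo 0 t, ‖g s‖ₑ := enorm_integral_le_lintegral_enorm _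
    _ = ∫⁻ s in Ioo 0 t, ((fun s => ‖g s‖ₑ * ENNReal.ofReal (s ^ (κ / p))) *
          fun s => ENNReal.ofReal (s ^ (-(κ / p)))) s := by
      refine setLIntegral_congr_fun measurableSet_Ioo fun s hs => ?_
      have hs0 : 0 < s := hs.1
      simp only [Pi.mul_apply]
      rw [mul_assoc, ← ENNReal.ofReal_mul (by positivity), ← Real.rpow_add hs0,
        add_neg_cancel, Real.rpow_zero, ENNReal.ofReal_one, mul_one]
    _ ≤ (∫⁻ s in Ioo 0 t, (‖g s‖ₑ * ENNReal.ofReal (s ^ (κ / p))) ^ p) ^ (1 / p) *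
          (∫⁻ s in Ioo 0 t, ENNReal.ofReal (s ^ (-(κ / p))) ^ (p / (p - 1))) ^
            (1 / (p / (p - 1))) :=
      ENNReal.lintegral_mul_le_Lp_mul_Lq _ hpq
        (hgt.enorm.mul (by fun_prop)) (by fun_prop)
    _ ≤ _ := by
      refine mul_le_mul' (ENNReal.rpow_le_rpow ?_ (by positivity)) (le_of_eq ?_)
      · rw [setLIntegral_congr_fun (g := fun s => ENNReal.ofReal (‖g s‖ ^ p * |s| ^ κ))
          measurableSet_Ioo]
        · exact lintegral_mono_set hsub
        · intro s hs
          have hs0 : 0 < s := hs.1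
          simp only
          rw [← ofReal_norm, ← ENNReal.ofReal_mul (norm_nonneg _),
            ENNReal.ofReal_rpow_of_nonneg (by positivity) hp0.le,
            Real.mul_rpow (norm_nonneg _) (by positivity), ← Real.rpow_mul hs0.le,
            div_mul_cancel₀ _ hp0.ne', abs_of_pos hs0]
      · rw [setLIntegral_congr_fun (g := fun s => ENNReal.ofReal (s ^ (-(κ / (p - 1)))))
          measurableSet_Ioo, lintegral_Ioo_rpow_neg ha ht.1, one_div_div,
          ENNReal.ofReal_rpow_of_nonneg _ (by positivity)]
        · exact div_nonneg (Real.rpow_nonneg ht.1.le _) (by linarith)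
        · intro s hs
          have hs0 : 0 < s := hs.1
          simp only
          rw [ENNReal.ofReal_rpow_of_nonneg (by positivity) (by positivity),
            ← Real.rpow_mul hs0.le]
          congr 2
          field_simp

/-- The weighted Poincaré inequality on `(0, T)` for functions vanishing at `0`. -/
lemma weightedNorm_integral_Ioo_le {X : Type*} [NormedAddCommGroup X] [NormedSpace ℝ X]
    {p κ T : ℝ} (hp : 1 < p) (hκ : κ < p - 1) (hT : 0 < T) {g : ℝ → X}
    (hg : AEStronglyMeasurable g (volume.restrict (Ioo 0 T))) :
    weightedNorm p κ (Ioo 0 T) (fun t => ∫ s in Ioo (0 : ℝ) t, g s) ≤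
      ENNReal.ofReal ((1 - κ / (p - 1)) ^ (-((p - 1) / p)) * T) *
        weightedNorm p κ (Ioo 0 T) g := by
  have hp0 : 0 < p := by linarith
  have hp1 : 0 < p - 1 := by linarith
  have ha : 0 < 1 - κ / (p - 1) := by rwa [sub_pos, div_lt_one hp1]
  set N := weightedNorm p κ (Ioo 0 T) g with hN
  set b := 1 - κ / (p - 1) with hb
  have hpt (t : ℝ) (ht : t ∈ Ioo 0 T) :
      ENNReal.ofReal (‖∫ s in Ioo 0 t, g s‖ ^ p * |t| ^ κ) ≤
        N ^ p * ENNReal.ofReal (b ^ (-(p - 1)) * T ^ (p - 1)) := by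
    have ht0 : 0 < t := ht.1
    have hreal : ((t ^ b / b) ^ ((p - 1) / p)) ^ p * t ^ κ = b ^ (-(p - 1)) * t ^ (p - 1) := by
      rw [← Real.rpow_mul (by positivity), div_mul_cancel₀ _ hp0.ne',
        Real.div_rpow (by positivity) ha.le, ← Real.rpow_mul ht0.le, Real.rpow_neg ha.le,
        div_mul_eq_mul_div, ← Real.rpow_add ht0, div_eq_inv_mul]
      congr 2
      rw [hb]
      field_simp
      ring
    calc ENNReal.ofReal (‖∫ s in Ioo 0 t, g s‖ ^ p * |t| ^ κ)
        = ‖∫ s in Ioo 0 t, g s‖ₑ ^ p * ENNReal.ofReal (t ^ κ) := by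
          rw [abs_of_pos ht0, ENNReal.ofReal_mul (by positivity),
            ← ENNReal.ofReal_rpow_of_nonneg (norm_nonneg _) hp0.le, ofReal_norm]
      _ ≤ (N * ENNReal.ofReal ((t ^ b / b) ^ ((p - 1) / p))) ^ p * ENNReal.ofReal (t ^ κ) := by
          gcongr
          exact enorm_integral_Ioo_le_weightedNorm hp hκ hg ht
      _ = N ^ p * ENNReal.ofReal (b ^ (-(p - 1)) * t ^ (p - 1)) := by
          rw [ENNReal.mul_rpow_of_nonneg _ _ hp0.le,
            ENNReal.ofReal_rpow_of_nonneg (by positivity) hp0.le, mul_assoc,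
            ← ENNReal.ofReal_mul (by positivity), hreal]
      _ ≤ _ := by
          gcongr
          exact ht.2.le
  calc weightedNorm p κ (Ioo 0 T) (fun t => ∫ s in Ioo (0 : ℝ) t, g s)
      ≤ (∫⁻ _ in Ioo 0 T, N ^ p * ENNReal.ofReal (b ^ (-(p - 1)) * T ^ (p - 1))) ^ (1 / p) :=
        ENNReal.rpow_le_rpow (setLIntegral_mono' measurableSet_Ioo hpt) (by positivity)
    _ = _ := by
      rw [setLIntegral_const, Real.volume_Ioo, sub_zero, mul_assoc,
        ← ENNReal.ofReal_mul (by positivity), ENNReal.mul_rpow_of_nonneg _ _ (by positivity),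
        ← ENNReal.rpow_mul, mul_one_div_cancel hp0.ne', ENNReal.rpow_one,
        ENNReal.ofReal_rpow_of_nonneg (by positivity) (by positivity), mul_comm, mul_assoc,
        ← Real.rpow_add_one hT.ne', sub_add_cancel, Real.mul_rpow (by positivity) (by positivity),
        ← Real.rpow_mul ha.le, ← Real.rpow_mul hT.le, mul_one_div_cancel hp0.ne', Real.rpow_one]
      congr 4
      ring

/-- (Key computation in the proof of Proposition 2.7(1) of the paper.) Let
`f(t) = ∫_0^t f'(s) ds`. If `h` satisfies
`‖h‖ ≤ C (‖s ↦ f(Ts)‖_{L^p((0,1),w_κ)} + ‖s ↦ T f'(Ts)‖_{L^p((0,1),w_κ)})`, then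
`‖t ↦ T⁻¹ h(t/T)‖_{L^p(ℝ,w_κ)} ≤ C (1 + C_{p,κ}) ‖f'‖_{L^p((0,T),w_κ)}`, where `C_{p,κ}` is any
constant for which the weighted Poincaré inequality holds; such a constant exists. -/
theorem stmt_5 {X : Type*} [NormedAddCommGroup X] [NormedSpace ℝ X] [CompleteSpace X]
    (p κ C Cpκ T : ℝ) (hp : 1 < p) (hκ₁ : -1 < κ) (hκ₂ : κ < p - 1)
    (hC : 0 ≤ C) (hCpκ : 0 ≤ Cpκ) (hT : 0 < T)
    (f' : ℝ → X) (hf' : AEStronglyMeasurable f' (volume.restrict (Ioo 0 T)))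
    (hfin : weightedNorm p κ (Ioo 0 T) f' < ⊤)
    (hPoin : weightedNorm p κ (Ioo 0 T) (fun t => ∫ s in Ioo (0 : ℝ) t, f' s) ≤
      ENNReal.ofReal (Cpκ * T) * weightedNorm p κ (Ioo 0 T) f')
    (h : ℝ → X) (hh : AEStronglyMeasurable h volume)
    (hhbd : weightedNorm p κ univ h ≤ ENNReal.ofReal C *
      (weightedNorm p κ (Ioo 0 1) (fun s => ∫ r in Ioo (0 : ℝ) (T * s), f' r) +
        weightedNorm p κ (Ioo 0 1) (fun s => T • f' (T * s)))) :
    (∃ C₀ : ℝ, 0 < C₀ ∧ ∀ T' : ℝ, 0 < T' → ∀ g : ℝ → X,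
        AEStronglyMeasurable g (volume.restrict (Ioo 0 T')) →
        weightedNorm p κ (Ioo 0 T') g < ⊤ →
        weightedNorm p κ (Ioo 0 T') (fun t => ∫ s in Ioo (0 : ℝ) t, g s) ≤
          ENNReal.ofReal (C₀ * T') * weightedNorm p κ (Ioo 0 T') g) ∧
      weightedNorm p κ univ (fun t => T⁻¹ • h (t / T)) ≤
        ENNReal.ofReal (C * (1 + Cpκ)) * weightedNorm p κ (Ioo 0 T) f' := by
  have hp0 : 0 < p := by linarith
  have hp1 : 0 < p - 1 := by linarith
  have ha : 0 < 1 - κ / (p - 1) := by rwa [sub_pos, div_lt_one hp1]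
  refine ⟨⟨(1 - κ / (p - 1)) ^ (-((p - 1) / p)), by positivity, fun T' hT' g hg _ =>
    weightedNorm_integral_Ioo_le hp hκ₂ hT' hg⟩, ?_⟩
  have hpre : (T * ·) ⁻¹' Ioo 0 T = Ioo 0 1 := by
    rw [preimage_const_mul_Ioo₀ _ _ hT, zero_div, div_self hT.ne']
  have hf := weightedNorm_comp_mul_left (κ := κ) hp0 hT (Ioo 0 T)
    (fun t => ∫ s in Ioo (0 : ℝ) t, f' s)
  have hdf := weightedNorm_comp_mul_left (κ := κ) hp0 hT (Ioo 0 T) f'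
  have hh' := weightedNorm_comp_mul_left (κ := κ) hp0 (inv_pos.2 hT) univ h
  rw [hpre] at hf hdf
  rw [preimage_univ] at hh'
  rw [weightedNorm_const_smul hp0 hT.le, hf, hdf] at hhbd
  simp_rw [div_eq_inv_mul]
  rw [weightedNorm_const_smul hp0 (inv_nonneg.2 hT.le), hh']
  set N := weightedNorm p κ (Ioo 0 T) f'
  set r := T ^ (-(κ + 1) / p) with hr
  have hr0 : 0 < r := by positivity
  rw [Real.inv_rpow hT.le, ← hr]
  calc ENNReal.ofReal T⁻¹ * (ENNReal.ofReal r⁻¹ * weightedNorm p κ univ h)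
      ≤ ENNReal.ofReal T⁻¹ * (ENNReal.ofReal r⁻¹ * (ENNReal.ofReal C *
          (ENNReal.ofReal r * (ENNReal.ofReal (Cpκ * T) * N) +
            ENNReal.ofReal T * (ENNReal.ofReal r * N)))) := by
        gcongr
        exact hhbd.trans (by gcongr)
    _ = ENNReal.ofReal (C * (1 + Cpκ)) * N := by
        simp only [← mul_assoc]
        rw [← ENNReal.ofReal_mul hr0.le, ← ENNReal.ofReal_mul hT.le, ← add_mul,
          ← ENNReal.ofReal_add (by positivity) (by positivity), ← mul_assoc,
          ← ENNReal.ofReal_mul (by positivity), ← ENNReal.ofReal_mul (by positivity),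
          ← ENNReal.ofReal_mul (by positivity)]
        congr 2
        field_simp
        ring
end

section
/- Assume the critical-exponent setting, the space V with seminorms, the truncation ξ_λ, and Θ_λ as in the context, with T > 0 and N ≥ 1. Let X₀ be a Banach space and F : [0,T] × V → X₀ satisfy, for some L > 0 and all t ∈ [0,T] and x, y ∈ V with ‖x‖_Tr ≤ N + 2 and ‖y‖_Tr ≤ N + 2: ‖F(t,x) − F(t,y)‖_{X₀} ≤ L Σ_{j=1}^m (1 + ‖x‖_{φ_j}^{ρ_j} + ‖y‖_{φ_j}^{ρ_j}) ‖x − y‖_{β_j}. For λ ∈ (0,1) and x ∈ V define F_{c,λ}(x,u)(t) := Θ_λ(t,x,u)(F(t,u(t)) − F(t,0)). Then there exist constants C_λ and L_{λ,T}, depending only on p, κ, m, the exponents, L, λ and T, such that for all x ∈ V with ‖x‖_Tr ≤ N and all u, v : [0,T] → V that are continuous in the ‖·‖_Tr-seminorm, have finite 𝔛(T)-norm, measurable composed seminorms, and strongly measurable compositions with F: (a) ‖F_{c,λ}(x,u)‖_{L^p((0,T),w_κ;X₀)} ≤ C_λ; (b) ‖F_{c,λ}(x,u) − F_{c,λ}(x,v)‖_{L^p((0,T),w_κ;X₀)}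 ≤ L_{λ,T} ( ‖u − v‖_{𝔛(T)} + sup_{s∈[0,T]} ‖u(s) − v(s)‖_Tr ). Moreover, for every ε > 0 there exist T̄ = T̄(ε) > 0 and λ̄ = λ̄(ε) > 0 such that L_{λ,T} < ε for all T ∈ (0,T̄) and λ ∈ (0,λ̄). -/
open MeasureTheory Set
open scoped ENNReal NNReal

/-- The norm of the space `𝔛(t)` of the paper (formula (4.6)). -/
noncomputable def XNorm {V : Type*} [AddCommGroup V] [Module ℝ V]
    (κ : ℝ) (m : ℕ) (q₁ q₂ : Fin m → ℝ)
    (nβ nφ : Fin m → Seminorm ℝ V) (t : ℝ) (u : ℝ → V) : ℝ≥0∞ :=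
  (∑ j : Fin m,
      (∫⁻ s in Ioo 0 t, ENNReal.ofReal (nβ j (u s) ^ q₁ j * s ^ κ)) ^ (1 / q₁ j)) +
    ∑ j : Fin m,
      (∫⁻ s in Ioo 0 t, ENNReal.ofReal (nφ j (u s) ^ q₂ j * s ^ κ)) ^ (1 / q₂ j)

/-- The truncation `ξ : [0,∞) → [0,1]`: `ξ = 1` on `[0,1]`, `ξ(s) = 2 - s` on `[1,2]`, `ξ = 0`
on `[2,∞)`. -/
noncomputable def xiCut (s : ℝ) : ℝ := min 1 (max 0 (2 - s))

/-- The truncation `Θ_λ(t,x,u) = ξ_λ(‖u‖_{𝔛(t)} + sup_{s∈[0,t]} ‖u(s) - x‖_Tr)` of (4.7). -/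
noncomputable def Theta {V : Type*} [AddCommGroup V] [Module ℝ V]
    (κ : ℝ) (m : ℕ) (q₁ q₂ : Fin m → ℝ) (nβ nφ : Fin m → Seminorm ℝ V)
    (nTr : Seminorm ℝ V) (lam t : ℝ) (x : V) (u : ℝ → V) : ℝ :=
  xiCut (((XNorm κ m q₁ q₂ nβ nφ t u).toReal +
      sSup ((fun s => nTr (u s - x)) '' Icc 0 t)) / lam)

/-- The measure on `ℝ` with density `s ^ κ`. -/
noncomputable def powWeight (κ : ℝ) : Measure ℝ :=
  volume.withDensity fun s => ENNReal.ofReal (s ^ κ)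

theorem lintegral_weight_rpow_eq_eLpNorm' {E : Type*} [NormedAddCommGroup E] (κ : ℝ) {q : ℝ}
    (hq : 0 ≤ q) {A : Set ℝ} (hA : MeasurableSet A) (f : ℝ → E) :
    (∫⁻ s in A, ENNReal.ofReal (‖f s‖ ^ q * s ^ κ)) ^ (1 / q) =
      eLpNorm' f q ((powWeight κ).restrict A) := by
  rw [eLpNorm', powWeight, setLIntegral_withDensity_eq_setLIntegral_mul_non_measurable]
  · congr 1
    refine lintegral_congr fun s => ?_
    rw [ENNReal.ofReal_mul (by positivity), ← ENNReal.ofReal_rpow_of_nonneg (norm_nonneg _) hq,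
      ofReal_norm, Pi.mul_apply, mul_comm]
  · fun_prop
  · exact hA
  · simp

instance powWeight.instNullSingletonClass (κ : ℝ) : NullSingletonClass (powWeight κ) :=
  ⟨fun s => withDensity_absolutelyContinuous _ _ (measure_singleton s)⟩

theorem powWeight_Ioo_le {κ : ℝ} (hκ : 0 ≤ κ) {T : ℝ} (hT : 0 < T) :
    powWeight κ (Ioo 0 T) ≤ ENNReal.ofReal (T ^ (1 + κ)) := by
  rw [powWeight, withDensity_apply _ measurableSet_Ioo]
  calc ∫⁻ s in Ioo 0 T, ENNReal.ofReal (s ^ κ)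
      ≤ ∫⁻ _ in Ioo 0 T, ENNReal.ofReal (T ^ κ) :=
        setLIntegral_mono measurable_const fun s hs => ENNReal.ofReal_le_ofReal
          (Real.rpow_le_rpow hs.1.le hs.2.le hκ)
    _ = ENNReal.ofReal (T ^ (1 + κ)) := by
        rw [setLIntegral_const, Real.volume_Ioo, sub_zero, ← ENNReal.ofReal_mul (by positivity),
          Real.rpow_add hT, Real.rpow_one, mul_comm]

theorem setLIntegral_le_of_forall_Ioo_le {μ : Measure ℝ} [NullSingletonClass μ] {S : Set ℝ} {a : ℝ}
    (hSa : S ⊆ Ioi a) (hS : BddAbove S) {f : ℝ → ℝ≥0∞} {c : ℝ≥0∞}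
    (h : ∀ t ∈ S, ∫⁻ s in Ioo a t, f s ∂μ ≤ c) : ∫⁻ s in S, f s ∂μ ≤ c := by
  rcases S.eq_empty_or_nonempty with rfl | hne
  · simp
  obtain ⟨t, ht_mono, ht_lim, htS⟩ := exists_seq_tendsto_sSup hne hS
  have hunion : Ioo a (sSup S) ⊆ ⋃ n, Ioo a (t n) := fun s hs => by
    obtain ⟨n, hn⟩ := (ht_lim.eventually (lt_mem_nhds hs.2)).exists
    exact mem_iUnion.2 ⟨n, hs.1, hn⟩
  calc ∫⁻ s in S, f s ∂μ ≤ ∫⁻ s in Ioc a (sSup S), f s ∂μ :=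
        lintegral_mono_set fun s hs => ⟨hSa hs, le_csSup hS hs⟩
    _ = ∫⁻ s in Ioo a (sSup S), f s ∂μ := (setLIntegral_congr Ioo_ae_eq_Ioc).symm
    _ ≤ ∫⁻ s in ⋃ n, Ioo a (t n), f s ∂μ := lintegral_mono_set hunion
    _ = ⨆ n, ∫⁻ s in Ioo a (t n), f s ∂μ :=
        setLIntegral_iUnion_of_directed _ (Monotone.directed_le fun _ _ hnk =>
          Ioo_subset_Ioo_right (ht_mono hnk))
    _ ≤ c := iSup_le fun n => h _ (htS n)

theorem eLpNorm'_restrict_le_of_forall_Ioo_le {μ : Measure ℝ} [NullSingletonClass μ] {S : Set ℝ} {a : ℝ}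
    (hSa : S ⊆ Ioi a) (hS : BddAbove S) {f : ℝ → ℝ} {q : ℝ} (hq : 0 < q) {c : ℝ≥0∞}
    (h : ∀ t ∈ S, eLpNorm' f q (μ.restrict (Ioo a t)) ≤ c) :
    eLpNorm' f q (μ.restrict S) ≤ c := by
  simp only [eLpNorm', one_div, ENNReal.rpow_inv_le_iff hq] at h ⊢
  exact setLIntegral_le_of_forall_Ioo_le hSa hS h

theorem eLpNorm'_indicator_restrict {α : Type*} [MeasurableSpace α] {μ : Measure α}
    {S A : Set α} (hS : MeasurableSet S) (hSA : S ⊆ A) (f : α → ℝ) {q : ℝ} (hq : 0 < q) :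
    eLpNorm' (S.indicator f) q (μ.restrict A) = eLpNorm' f q (μ.restrict S) := by
  have : (fun s => ‖S.indicator f s‖ₑ ^ q) = S.indicator fun s => ‖f s‖ₑ ^ q := by
    ext s
    by_cases hs : s ∈ S <;> simp [hs, hq]
  rw [eLpNorm', eLpNorm', this, lintegral_indicator hS, Measure.restrict_restrict hS,
    inter_eq_left.2 hSA]

theorem eLpNorm'_critical_term_le {α : Type*} [MeasurableSpace α] {μ : Measure α}
    {p q₁ q₂ σ : ℝ} (hp : 1 ≤ p) (hσ : 0 < σ) (hq₂ : 0 < q₂) (hpq₁ : p < q₁)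
    (hpq : 1 / p = σ / q₂ + 1 / q₁) {Φ B : α → ℝ} (hΦ : Measurable Φ) (hB : Measurable B)
    (hΦ0 : ∀ s, 0 ≤ Φ s) {M R R' : ℝ≥0∞} (hM : μ univ ^ (1 / p - 1 / q₁) ≤ M)
    (hR : eLpNorm' Φ q₂ μ ≤ R) (hR' : eLpNorm' B q₁ μ ≤ R') :
    eLpNorm' (fun s => (3 + Φ s ^ σ) * B s) p μ ≤ (3 * M + R ^ σ) * R' := by
  have hp0 : 0 < p := by linarith
  have hsplit : (fun s => (3 + Φ s ^ σ) * B s) = (3 : ℝ) • B + (fun s => Φ s ^ σ * B s) := by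
    ext s
    simp only [Pi.add_apply, Pi.smul_apply, smul_eq_mul]
    ring
  have hpow : eLpNorm' (fun s => Φ s ^ σ) (q₂ / σ) μ = eLpNorm' Φ q₂ μ ^ σ := by
    have := eLpNorm'_norm_rpow (μ := μ) Φ (q₂ / σ) σ hσ
    rw [div_mul_cancel₀ _ hσ.ne'] at this
    rw [← this]
    simp only [Real.norm_of_nonneg (hΦ0 _)]
  have hlt : p < q₂ / σ := by
    have h1 : 0 < 1 / q₁ := one_div_pos.2 (hp0.trans hpq₁)
    have h2 : 1 / (q₂ / σ) < 1 / p := by rw [hpq, one_div_div]; linarith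
    exact (one_div_lt_one_div (by positivity) hp0).1 h2
  have hprod : eLpNorm' (fun s => Φ s ^ σ * B s) p μ ≤ R ^ σ * R' := by
    have := ENNReal.lintegral_Lp_mul_le_Lq_mul_Lr hp0 hlt (r := q₁)
      (by rw [hpq, one_div_div]) μ (f := fun s => ‖Φ s ^ σ‖ₑ) (g := fun s => ‖B s‖ₑ)
      (by fun_prop) (by fun_prop)
    calc eLpNorm' (fun s => Φ s ^ σ * B s) p μ
        ≤ eLpNorm' (fun s => Φ s ^ σ) (q₂ / σ) μ * eLpNorm' B q₁ μ := by
          simpa only [eLpNorm', enorm_mul, Pi.mul_apply] using this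
      _ ≤ R ^ σ * R' := by
          rw [hpow]
          gcongr
  have hconst : eLpNorm' ((3 : ℝ) • B) p μ ≤ 3 * (R' * M) := by
    refine (eLpNorm'_const_smul_le hp0).trans ?_
    rw [show ‖(3 : ℝ)‖ₑ = 3 by simp [enorm_eq_nnnorm]]
    gcongr
    exact (eLpNorm'_le_eLpNorm'_mul_rpow_measure_univ hp0 hpq₁.le
      hB.aestronglyMeasurable).trans (by gcongr)
  rw [hsplit]
  refine (eLpNorm'_add_le (hB.const_smul (3 : ℝ)).aestronglyMeasurable
    (by fun_prop) hp).trans ?_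
  calc _ ≤ 3 * (R' * M) + R ^ σ * R' := add_le_add hconst hprod
    _ = _ := by ring

/-- The growth function `L ∑ j, (3 + Φ j ^ σ j) * B j` dominating the critical nonlinearity. -/
noncomputable def criticalGrowth {α : Type*} {m : ℕ} (L : ℝ) (σ : Fin m → ℝ)
    (Φ B : Fin m → α → ℝ) (s : α) : ℝ :=
  L * ∑ j, (3 + Φ j s ^ σ j) * B j s

theorem criticalGrowth_nonneg {α : Type*} {m : ℕ} {L : ℝ} (hL : 0 ≤ L) {σ : Fin m → ℝ}
    {Φ B : Fin m → α → ℝ} (hΦ : ∀ j s, 0 ≤ Φ j s) (hB : ∀ j s, 0 ≤ B j s) (s : α) :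
    0 ≤ criticalGrowth L σ Φ B s :=
  mul_nonneg hL <| Finset.sum_nonneg fun j _ =>
    mul_nonneg (by have := Real.rpow_nonneg (hΦ j s) (σ j); linarith) (hB j s)

theorem measurable_criticalGrowth {α : Type*} [MeasurableSpace α] {m : ℕ} (L : ℝ)
    (σ : Fin m → ℝ) {Φ B : Fin m → α → ℝ} (hΦ : ∀ j, Measurable (Φ j))
    (hB : ∀ j, Measurable (B j)) : Measurable (criticalGrowth L σ Φ B) := by
  unfold criticalGrowth
  fun_prop

theorem eLpNorm'_criticalGrowth_le {α : Type*} [MeasurableSpace α] {μ : Measure α} {m : ℕ}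
    {L p : ℝ} {q₁ q₂ σ : Fin m → ℝ} (hp : 1 ≤ p) (hσ : ∀ j, 0 < σ j) (hq₂ : ∀ j, 0 < q₂ j)
    (hpq₁ : ∀ j, p < q₁ j) (hpq : ∀ j, 1 / p = σ j / q₂ j + 1 / q₁ j) {Φ B : Fin m → α → ℝ}
    (hΦ : ∀ j, Measurable (Φ j)) (hB : ∀ j, Measurable (B j)) (hΦ0 : ∀ j s, 0 ≤ Φ j s)
    {M : Fin m → ℝ≥0∞} {R R' : ℝ≥0∞} (hM : ∀ j, μ univ ^ (1 / p - 1 / q₁ j) ≤ M j)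
    (hR : ∀ j, eLpNorm' (Φ j) (q₂ j) μ ≤ R) (hR' : ∀ j, eLpNorm' (B j) (q₁ j) μ ≤ R') :
    eLpNorm' (criticalGrowth L σ Φ B) p μ ≤ ‖L‖ₑ * (∑ j, (3 * M j + R ^ σ j)) * R' := by
  have hfun : criticalGrowth L σ Φ B = L • ∑ j, fun s => (3 + Φ j s ^ σ j) * B j s := by
    ext s
    simp [criticalGrowth]
  rw [hfun, mul_assoc, Finset.sum_mul]
  refine (eLpNorm'_const_smul_le (by linarith)).trans ?_
  gcongr
  refine (eLpNorm'_sum_le (fun j _ => ?_) hp).trans (Finset.sum_le_sum fun j _ =>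
    eLpNorm'_critical_term_le hp (hσ j) (hq₂ j) (hpq₁ j) (hpq j) (hΦ j) (hB j) (hΦ0 j) (hM j)
      (hR j) (hR' j))
  have := hΦ j
  have := hB j
  fun_prop

theorem xiCut_nonneg (s : ℝ) : 0 ≤ xiCut s := le_min zero_le_one (le_max_left _ _)

theorem xiCut_le_one (s : ℝ) : xiCut s ≤ 1 := min_le_left _ _

theorem xiCut_eq_zero {s : ℝ} (hs : 2 ≤ s) : xiCut s = 0 := by
  rw [xiCut, max_eq_left (by linarith), min_eq_right zero_le_one]

theorem abs_xiCut_sub_le (s t : ℝ) : |xiCut s - xiCut t| ≤ |s - t| := by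
  rw [xiCut, xiCut]
  calc _ ≤ |max 0 (2 - s) - max 0 (2 - t)| := by
        simpa using abs_min_sub_min_le_max 1 (max 0 (2 - s)) 1 (max 0 (2 - t))
    _ ≤ |(2 - s) - (2 - t)| := by
        simpa using abs_max_sub_max_le_max 0 (2 - s) 0 (2 - t)
    _ = |s - t| := by rw [sub_sub_sub_cancel_left, abs_sub_comm]

theorem norm_xiCut_smul_le {E : Type*} [NormedAddCommGroup E] [NormedSpace ℝ E] {lam a : ℝ}
    (hlam : 0 < lam) (f : E) :
    ‖xiCut (a / lam) • f‖ ≤ if a < 2 * lam then ‖f‖ else 0 := by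
  split_ifs with ha
  · rw [norm_smul, Real.norm_of_nonneg (xiCut_nonneg _)]
    exact mul_le_of_le_one_left (norm_nonneg _) (xiCut_le_one _)
  · rw [xiCut_eq_zero ((le_div_iff₀ hlam).2 (not_lt.1 ha))]
    simp

theorem norm_xiCut_smul_sub_le_of_le {E : Type*} [NormedAddCommGroup E] [NormedSpace ℝ E]
    {lam a b δ : ℝ} (hlam : 0 < lam) (hab : a ≤ b) (hδ : |a - b| ≤ δ) (f g : E) :
    ‖xiCut (a / lam) • f - xiCut (b / lam) • g‖ ≤
      (if a < 2 * lam then δ / lam * ‖f‖ else 0) +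
        if a < 2 * lam ∧ b < 2 * lam then ‖f - g‖ else 0 := by
  have hsplit : xiCut (a / lam) • f - xiCut (b / lam) • g =
      (xiCut (a / lam) - xiCut (b / lam)) • f + xiCut (b / lam) • (f - g) := by
    rw [sub_smul, smul_sub]
    abel
  have hdiff : |xiCut (a / lam) - xiCut (b / lam)| ≤ δ / lam := by
    refine (abs_xiCut_sub_le _ _).trans ?_
    rw [← sub_div, abs_div, abs_of_pos hlam]
    gcongr
  rw [hsplit]
  refine (norm_add_le _ _).trans (add_le_add ?_ ?_)
  · split_ifs with ha
    · rw [norm_smul]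
      exact mul_le_mul_of_nonneg_right hdiff (norm_nonneg _)
    · have ha' := not_lt.1 ha
      rw [xiCut_eq_zero ((le_div_iff₀ hlam).2 ha'),
        xiCut_eq_zero ((le_div_iff₀ hlam).2 (ha'.trans hab))]
      simp
  · refine (norm_xiCut_smul_le hlam _).trans (le_of_eq (if_congr ?_ rfl rfl))
    exact ⟨fun hb => ⟨hab.trans_lt hb, hb⟩, And.right⟩

theorem norm_xiCut_smul_sub_le {E : Type*} [NormedAddCommGroup E] [NormedSpace ℝ E]
    {lam a b δ : ℝ} (hlam : 0 < lam) (hδ : |a - b| ≤ δ) (f g : E) :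
    ‖xiCut (a / lam) • f - xiCut (b / lam) • g‖ ≤
      (if a < 2 * lam then δ / lam * ‖f‖ else 0) + (if b < 2 * lam then δ / lam * ‖g‖ else 0) +
        if a < 2 * lam ∧ b < 2 * lam then ‖f - g‖ else 0 := by
  have hδ0 : 0 ≤ δ := (abs_nonneg _).trans hδ
  have h0 : ∀ (c : ℝ) (h : E), 0 ≤ if c < 2 * lam then δ / lam * ‖h‖ else 0 := fun c h => by
    split_ifs <;> positivity
  rcases le_total a b with hab | hab
  · refine (norm_xiCut_smul_sub_le_of_le hlam hab hδ f g).trans ?_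
    linarith [h0 b g]
  · have := norm_xiCut_smul_sub_le_of_le hlam hab (abs_sub_comm a b ▸ hδ) g f
    rw [norm_sub_rev, norm_sub_rev g f] at this
    simp only [and_comm (a := b < 2 * lam)] at this
    linarith [h0 a f]

theorem rpow_le_one_add_rpow {x a b : ℝ} (hx : 0 ≤ x) (ha : 0 ≤ a) (hab : a ≤ b) :
    x ^ a ≤ 1 + x ^ b := by
  rcases le_total x 1 with h | h
  · linarith [Real.rpow_le_one hx h ha, Real.rpow_nonneg hx b]
  · linarith [Real.rpow_le_rpow_of_exponent_le h hab]

section XNorm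

variable {V : Type*} [AddCommGroup V] [Module ℝ V] {κ : ℝ} {m : ℕ} {q₁ q₂ : Fin m → ℝ}
  {nβ nφ : Fin m → Seminorm ℝ V} {nTr : Seminorm ℝ V}

theorem XNorm_eq_sum_eLpNorm' (hq₁ : ∀ j, 0 ≤ q₁ j) (hq₂ : ∀ j, 0 ≤ q₂ j) (t : ℝ) (u : ℝ → V) :
    XNorm κ m q₁ q₂ nβ nφ t u =
      (∑ j, eLpNorm' (fun s => nβ j (u s)) (q₁ j) ((powWeight κ).restrict (Ioo 0 t))) +
        ∑ j, eLpNorm' (fun s => nφ j (u s)) (q₂ j) ((powWeight κ).restrict (Ioo 0 t)) := by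
  simp only [XNorm, ← lintegral_weight_rpow_eq_eLpNorm' κ (hq₁ _) measurableSet_Ioo,
    ← lintegral_weight_rpow_eq_eLpNorm' κ (hq₂ _) measurableSet_Ioo,
    Real.norm_of_nonneg (apply_nonneg _ _)]

theorem eLpNorm'_le_XNorm_left (hq₁ : ∀ j, 0 ≤ q₁ j) (hq₂ : ∀ j, 0 ≤ q₂ j) (t : ℝ)
    (u : ℝ → V) (j : Fin m) :
    eLpNorm' (fun s => nβ j (u s)) (q₁ j) ((powWeight κ).restrict (Ioo 0 t)) ≤
      XNorm κ m q₁ q₂ nβ nφ t u := by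
  rw [XNorm_eq_sum_eLpNorm' hq₁ hq₂]
  exact (Finset.single_le_sum (f := fun j => eLpNorm' (fun s => nβ j (u s)) (q₁ j)
    ((powWeight κ).restrict (Ioo 0 t))) (fun _ _ => zero_le) (Finset.mem_univ j)).trans
      le_self_add

theorem eLpNorm'_le_XNorm_right (hq₁ : ∀ j, 0 ≤ q₁ j) (hq₂ : ∀ j, 0 ≤ q₂ j) (t : ℝ)
    (u : ℝ → V) (j : Fin m) :
    eLpNorm' (fun s => nφ j (u s)) (q₂ j) ((powWeight κ).restrict (Ioo 0 t)) ≤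
      XNorm κ m q₁ q₂ nβ nφ t u := by
  rw [XNorm_eq_sum_eLpNorm' hq₁ hq₂]
  exact (Finset.single_le_sum (f := fun j => eLpNorm' (fun s => nφ j (u s)) (q₂ j)
    ((powWeight κ).restrict (Ioo 0 t))) (fun _ _ => zero_le) (Finset.mem_univ j)).trans
      le_add_self

theorem XNorm_mono (hq₁ : ∀ j, 0 ≤ q₁ j) (hq₂ : ∀ j, 0 ≤ q₂ j) (u : ℝ → V) {t t' : ℝ}
    (h : t ≤ t') : XNorm κ m q₁ q₂ nβ nφ t u ≤ XNorm κ m q₁ q₂ nβ nφ t' u := by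
  have hμ := Measure.restrict_mono_set (powWeight κ) (Ioo_subset_Ioo_right h : Ioo 0 t ⊆ Ioo 0 t')
  rw [XNorm_eq_sum_eLpNorm' hq₁ hq₂, XNorm_eq_sum_eLpNorm' hq₁ hq₂]
  exact add_le_add (Finset.sum_le_sum fun j _ => eLpNorm'_mono_measure _ hμ (hq₁ j))
    (Finset.sum_le_sum fun j _ => eLpNorm'_mono_measure _ hμ (hq₂ j))

theorem XNorm_le_add (hq₁ : ∀ j, 1 ≤ q₁ j) (hq₂ : ∀ j, 1 ≤ q₂ j) {u v w : ℝ → V}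
    (hβ : ∀ j s, nβ j (u s) ≤ nβ j (v s) + nβ j (w s))
    (hφ : ∀ j s, nφ j (u s) ≤ nφ j (v s) + nφ j (w s))
    (hvβ : ∀ j, Measurable fun s => nβ j (v s)) (hvφ : ∀ j, Measurable fun s => nφ j (v s))
    (hwβ : ∀ j, Measurable fun s => nβ j (w s)) (hwφ : ∀ j, Measurable fun s => nφ j (w s))
    (t : ℝ) :
    XNorm κ m q₁ q₂ nβ nφ t u ≤ XNorm κ m q₁ q₂ nβ nφ t v + XNorm κ m q₁ q₂ nβ nφ t w := by
  have key : ∀ {n : Seminorm ℝ V} {q : ℝ}, 1 ≤ q → (∀ s, n (u s) ≤ n (v s) + n (w s)) →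
      (Measurable fun s => n (v s)) → (Measurable fun s => n (w s)) →
      eLpNorm' (fun s => n (u s)) q ((powWeight κ).restrict (Ioo 0 t)) ≤
        eLpNorm' (fun s => n (v s)) q ((powWeight κ).restrict (Ioo 0 t)) +
          eLpNorm' (fun s => n (w s)) q ((powWeight κ).restrict (Ioo 0 t)) := by
    intro n q hq hn hv hw
    refine (eLpNorm'_mono_ae (by linarith) (.of_forall fun s => ?_)).trans
      (eLpNorm'_add_le hv.aestronglyMeasurable hw.aestronglyMeasurable hq)
    rw [Pi.add_apply, Real.norm_of_nonneg (apply_nonneg _ _),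
      Real.norm_of_nonneg (add_nonneg (apply_nonneg _ _) (apply_nonneg _ _))]
    exact hn s
  have h₁ : ∀ j, 0 ≤ q₁ j := fun j => zero_le_one.trans (hq₁ j)
  have h₂ : ∀ j, 0 ≤ q₂ j := fun j => zero_le_one.trans (hq₂ j)
  rw [XNorm_eq_sum_eLpNorm' h₁ h₂, XNorm_eq_sum_eLpNorm' h₁ h₂, XNorm_eq_sum_eLpNorm' h₁ h₂,
    add_add_add_comm]
  refine (?_ : _ ≤ _).trans_eq (congrArg₂ (· + ·) Finset.sum_add_distrib Finset.sum_add_distrib)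
  exact add_le_add (Finset.sum_le_sum fun j _ => key (hq₁ j) (hβ j) (hvβ j) (hwβ j))
    (Finset.sum_le_sum fun j _ => key (hq₂ j) (hφ j) (hvφ j) (hwφ j))

theorem bddAbove_seminorm_sub_image {u : ℝ → V} {K : Set ℝ} (hK : IsCompact K)
    (hu : ∀ s₀ ∈ K, Filter.Tendsto (fun s => nTr (u s - u s₀)) (nhdsWithin s₀ K) (nhds 0))
    (x : V) : BddAbove ((fun s => nTr (u s - x)) '' K) := by
  refine hK.bddAbove_image fun s₀ hs₀ => tendsto_iff_dist_tendsto_zero.2 ?_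
  refine squeeze_zero (fun _ => dist_nonneg) (fun s => ?_) (hu s₀ hs₀)
  rw [Real.dist_eq]
  simpa using abs_sub_map_le_sub nTr (u s - x) (u s₀ - x)

/-- The argument `‖u‖_{𝔛(t)} + sup_{s ∈ [0,t]} ‖u s - x‖_Tr` of the truncation `ξ_λ`. -/
noncomputable def truncArg (κ : ℝ) (m : ℕ) (q₁ q₂ : Fin m → ℝ) (nβ nφ : Fin m → Seminorm ℝ V)
    (nTr : Seminorm ℝ V) (x : V) (u : ℝ → V) (t : ℝ) : ℝ :=
  (XNorm κ m q₁ q₂ nβ nφ t u).toReal + sSup ((fun s => nTr (u s - x)) '' Icc 0 t)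

/-- The times in `(0,T)` at which the truncation argument lies below `2 * lam`. -/
def activeSet (κ : ℝ) (m : ℕ) (q₁ q₂ : Fin m → ℝ) (nβ nφ : Fin m → Seminorm ℝ V)
    (nTr : Seminorm ℝ V) (x : V) (u : ℝ → V) (lam T : ℝ) : Set ℝ :=
  {t | t ∈ Ioo 0 T ∧ truncArg κ m q₁ q₂ nβ nφ nTr x u t < 2 * lam}

theorem sSup_seminorm_image_nonneg (w : ℝ → V) (A : Set ℝ) :
    0 ≤ sSup ((fun s => nTr (w s)) '' A) :=
  Real.sSup_nonneg (by rintro _ ⟨s, _, rfl⟩; exact apply_nonneg _ _)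

theorem truncArg_mono (hq₁ : ∀ j, 0 ≤ q₁ j) (hq₂ : ∀ j, 0 ≤ q₂ j) {u : ℝ → V} {x : V} {T : ℝ}
    (hX : XNorm κ m q₁ q₂ nβ nφ T u < ⊤) (hb : BddAbove ((fun s => nTr (u s - x)) '' Icc 0 T))
    {s t : ℝ} (hs : 0 ≤ s) (hst : s ≤ t) (ht : t ≤ T) :
    truncArg κ m q₁ q₂ nβ nφ nTr x u s ≤ truncArg κ m q₁ q₂ nβ nφ nTr x u t := by
  refine add_le_add (ENNReal.toReal_mono ((XNorm_mono hq₁ hq₂ u ht).trans_lt hX).ne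
    (XNorm_mono hq₁ hq₂ u hst)) (csSup_le_csSup (hb.mono ?_) ((nonempty_Icc.2 hs).image _) ?_)
  · exact image_mono (Icc_subset_Icc_right ht)
  · exact image_mono (Icc_subset_Icc_right hst)

theorem truncArg_le_add (hq₁ : ∀ j, 1 ≤ q₁ j) (hq₂ : ∀ j, 1 ≤ q₂ j) {u v w : ℝ → V} {x : V}
    {T t : ℝ} (ht0 : 0 ≤ t) (htT : t ≤ T)
    (hβ : ∀ j s, nβ j (u s) ≤ nβ j (v s) + nβ j (w s))
    (hφ : ∀ j s, nφ j (u s) ≤ nφ j (v s) + nφ j (w s))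
    (hTr : ∀ s, nTr (u s - x) ≤ nTr (v s - x) + nTr (w s))
    (hvβ : ∀ j, Measurable fun s => nβ j (v s)) (hvφ : ∀ j, Measurable fun s => nφ j (v s))
    (hwβ : ∀ j, Measurable fun s => nβ j (w s)) (hwφ : ∀ j, Measurable fun s => nφ j (w s))
    (hv : XNorm κ m q₁ q₂ nβ nφ T v < ⊤) (hw : XNorm κ m q₁ q₂ nβ nφ T w < ⊤)
    (hvb : BddAbove ((fun s => nTr (v s - x)) '' Icc 0 T))
    (hwb : BddAbove ((fun s => nTr (w s)) '' Icc 0 T)) :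
    truncArg κ m q₁ q₂ nβ nφ nTr x u t ≤ truncArg κ m q₁ q₂ nβ nφ nTr x v t +
      ((XNorm κ m q₁ q₂ nβ nφ T w).toReal + sSup ((fun s => nTr (w s)) '' Icc 0 T)) := by
  have h₁ : ∀ j, 0 ≤ q₁ j := fun j => zero_le_one.trans (hq₁ j)
  have h₂ : ∀ j, 0 ≤ q₂ j := fun j => zero_le_one.trans (hq₂ j)
  have hvt := ((XNorm_mono h₁ h₂ v htT).trans_lt hv).ne
  have hX : (XNorm κ m q₁ q₂ nβ nφ t u).toReal ≤
      (XNorm κ m q₁ q₂ nβ nφ t v).toReal + (XNorm κ m q₁ q₂ nβ nφ T w).toReal := by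
    rw [← ENNReal.toReal_add hvt hw.ne]
    refine ENNReal.toReal_mono (ENNReal.add_ne_top.2 ⟨hvt, hw.ne⟩)
      ((XNorm_le_add hq₁ hq₂ hβ hφ hvβ hvφ hwβ hwφ t).trans ?_)
    gcongr
    exact XNorm_mono h₁ h₂ w htT
  have hS : sSup ((fun s => nTr (u s - x)) '' Icc 0 t) ≤
      sSup ((fun s => nTr (v s - x)) '' Icc 0 t) + sSup ((fun s => nTr (w s)) '' Icc 0 T) := by
    refine csSup_le ((nonempty_Icc.2 ht0).image _) ?_
    rintro _ ⟨s, hs, rfl⟩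
    exact (hTr s).trans (add_le_add
      (le_csSup (hvb.mono (image_mono (Icc_subset_Icc_right htT))) (mem_image_of_mem _ hs))
      (le_csSup hwb (mem_image_of_mem _ (Icc_subset_Icc_right htT hs))))
  rw [truncArg, truncArg]
  linarith

theorem measurableSet_activeSet (hq₁ : ∀ j, 0 ≤ q₁ j) (hq₂ : ∀ j, 0 ≤ q₂ j) {u : ℝ → V} {x : V}
    {T lam : ℝ} (hX : XNorm κ m q₁ q₂ nβ nφ T u < ⊤)
    (hb : BddAbove ((fun s => nTr (u s - x)) '' Icc 0 T)) :
    MeasurableSet (activeSet κ m q₁ q₂ nβ nφ nTr x u lam T) := by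
  refine OrdConnected.measurableSet ⟨fun s hs t ht r hr => ⟨⟨hs.1.1.trans_le hr.1,
    hr.2.trans_lt ht.1.2⟩, ?_⟩⟩
  exact (truncArg_mono hq₁ hq₂ hX hb (hs.1.1.le.trans hr.1) hr.2 ht.1.2.le).trans_lt ht.2

theorem XNorm_le_of_mem_activeSet (hq₁ : ∀ j, 0 ≤ q₁ j) (hq₂ : ∀ j, 0 ≤ q₂ j) {u : ℝ → V}
    {x : V} {T lam t : ℝ} (hX : XNorm κ m q₁ q₂ nβ nφ T u < ⊤)
    (ht : t ∈ activeSet κ m q₁ q₂ nβ nφ nTr x u lam T) :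
    XNorm κ m q₁ q₂ nβ nφ t u ≤ ENNReal.ofReal (2 * lam) := by
  rw [← ENNReal.ofReal_toReal ((XNorm_mono hq₁ hq₂ u ht.1.2.le).trans_lt hX).ne]
  refine ENNReal.ofReal_le_ofReal ?_
  have := ht.2
  rw [truncArg] at this
  linarith [sSup_seminorm_image_nonneg (nTr := nTr) (fun s => u s - x) (Icc 0 t)]

theorem seminorm_le_of_mem_activeSet {u : ℝ → V} {x : V} {T lam t N : ℝ}
    (hb : BddAbove ((fun s => nTr (u s - x)) '' Icc 0 T)) (hlam : lam < 1) (hx : nTr x ≤ N)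
    (ht : t ∈ activeSet κ m q₁ q₂ nβ nφ nTr x u lam T) : nTr (u t) ≤ N + 2 := by
  have h1 : nTr (u t - x) ≤ sSup ((fun s => nTr (u s - x)) '' Icc 0 t) :=
    le_csSup (hb.mono (image_mono (Icc_subset_Icc_right ht.1.2.le)))
      (mem_image_of_mem _ (right_mem_Icc.2 ht.1.1.le))
  have h2 := ht.2
  rw [truncArg] at h2
  have h3 : nTr (u t) ≤ nTr (u t - x) + nTr x := by
    simpa using map_add_le_add nTr (u t - x) x
  linarith [ENNReal.toReal_nonneg (a := XNorm κ m q₁ q₂ nβ nφ t u)]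

theorem eLpNorm'_indicator_activeSet_criticalGrowth_le {L p T lam : ℝ} {β σ : Fin m → ℝ}
    (hκ : 0 ≤ κ) (hT : 0 < T) (hlam : 0 < lam) (hL : 0 ≤ L)
    (hp : 1 ≤ p) (hσ : ∀ j, 0 < σ j) (hq₁ : ∀ j, 0 ≤ q₁ j) (hq₂ : ∀ j, 0 < q₂ j)
    (hpq₁ : ∀ j, p < q₁ j) (hpq : ∀ j, 1 / p = σ j / q₂ j + 1 / q₁ j)
    (hβ : ∀ j, (1 + κ) * (1 / p - 1 / q₁ j) = 1 - β j)
    {u : ℝ → V} {x : V} (hX : XNorm κ m q₁ q₂ nβ nφ T u < ⊤)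
    (hb : BddAbove ((fun s => nTr (u s - x)) '' Icc 0 T))
    (hΦ : ∀ j, Measurable fun s => nφ j (u s)) {B : Fin m → ℝ → ℝ} (hB : ∀ j, Measurable (B j))
    {R' : ℝ≥0∞} (hR' : ∀ j, eLpNorm' (B j) (q₁ j) ((powWeight κ).restrict
      (activeSet κ m q₁ q₂ nβ nφ nTr x u lam T)) ≤ R') :
    eLpNorm' ((activeSet κ m q₁ q₂ nβ nφ nTr x u lam T).indicator
        (criticalGrowth L σ (fun j s => nφ j (u s)) B)) p ((powWeight κ).restrict (Ioo 0 T)) ≤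
      ENNReal.ofReal (L * ∑ j, (3 * T ^ (1 - β j) + (2 * lam) ^ σ j)) * R' := by
  set S := activeSet κ m q₁ q₂ nβ nφ nTr x u lam T with hS
  have hSsub : S ⊆ Ioo 0 T := fun t ht => ht.1
  have hq₂' : ∀ j, 0 ≤ q₂ j := fun j => (hq₂ j).le
  rw [eLpNorm'_indicator_restrict (measurableSet_activeSet hq₁ hq₂' hX hb) hSsub _
    (by linarith)]
  refine (eLpNorm'_criticalGrowth_le hp hσ hq₂ hpq₁ hpq hΦ hB (fun _ _ => apply_nonneg _ _)
    (M := fun j => ENNReal.ofReal (T ^ (1 - β j))) (R := ENNReal.ofReal (2 * lam))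
    (fun j => ?_) (fun j => ?_) hR').trans_eq ?_
  · have hexp : 0 ≤ 1 / p - 1 / q₁ j := by
      rw [sub_nonneg]
      exact one_div_le_one_div_of_le (by linarith) (hpq₁ j).le
    rw [Measure.restrict_apply_univ, ← hβ j, Real.rpow_mul hT.le,
      ← ENNReal.ofReal_rpow_of_nonneg (by positivity) hexp]
    gcongr
    exact (measure_mono hSsub).trans (powWeight_Ioo_le hκ hT)
  · exact eLpNorm'_restrict_le_of_forall_Ioo_le (fun t ht => ht.1.1)
      (bddAbove_Ioo.mono hSsub) (hq₂ j) fun t ht =>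
        (eLpNorm'_le_XNorm_right hq₁ hq₂' t u j).trans (XNorm_le_of_mem_activeSet hq₁ hq₂' hX ht)
  · congr 1
    rw [ENNReal.ofReal_mul hL, Real.enorm_of_nonneg hL, ENNReal.ofReal_sum_of_nonneg
      (fun j _ => by positivity)]
    congr 1
    refine Finset.sum_congr rfl fun j _ => ?_
    rw [ENNReal.ofReal_add (by positivity) (by positivity),
      ENNReal.ofReal_mul (p := 3) (by norm_num),
      ENNReal.ofReal_rpow_of_nonneg (by positivity) (hσ j).le]
    simp

theorem eLpNorm'_restrict_activeSet_le {T lam : ℝ} (hq₁ : ∀ j, 0 < q₁ j) (hq₂ : ∀ j, 0 ≤ q₂ j)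
    {u : ℝ → V} {x : V} (hX : XNorm κ m q₁ q₂ nβ nφ T u < ⊤) (j : Fin m) :
    eLpNorm' (fun s => nβ j (u s)) (q₁ j) ((powWeight κ).restrict
      (activeSet κ m q₁ q₂ nβ nφ nTr x u lam T)) ≤ ENNReal.ofReal (2 * lam) := by
  have hq₁' : ∀ j, 0 ≤ q₁ j := fun j => (hq₁ j).le
  exact eLpNorm'_restrict_le_of_forall_Ioo_le (fun t ht => ht.1.1)
    (bddAbove_Ioo.mono fun t ht => ht.1) (hq₁ j) fun t ht =>
      (eLpNorm'_le_XNorm_left hq₁' hq₂ t u j).trans (XNorm_le_of_mem_activeSet hq₁' hq₂ hX ht)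

theorem eLpNorm'_restrict_activeSet_add_le {T lam δ : ℝ} (hlam : 0 < lam) (hδ : 0 ≤ δ)
    (hq₁ : ∀ j, 1 ≤ q₁ j) (hq₂ : ∀ j, 0 ≤ q₂ j) {u w : ℝ → V} {x : V}
    (hX : XNorm κ m q₁ q₂ nβ nφ T u < ⊤) (hw : XNorm κ m q₁ q₂ nβ nφ T w ≤ ENNReal.ofReal δ)
    (huβ : ∀ j, Measurable fun s => nβ j (u s)) (hwβ : ∀ j, Measurable fun s => nβ j (w s))
    (j : Fin m) :
    eLpNorm' (fun s => δ / lam * nβ j (u s) + nβ j (w s)) (q₁ j) ((powWeight κ).restrict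
      (activeSet κ m q₁ q₂ nβ nφ nTr x u lam T)) ≤ ENNReal.ofReal (3 * δ) := by
  have hq₁' : ∀ j, 0 < q₁ j := fun j => zero_lt_one.trans_le (hq₁ j)
  set μ := (powWeight κ).restrict (activeSet κ m q₁ q₂ nβ nφ nTr x u lam T) with hμ
  have hμle : μ ≤ (powWeight κ).restrict (Ioo 0 T) :=
    Measure.restrict_mono_set _ fun t ht => ht.1
  have h1 : eLpNorm' ((δ / lam) • fun s => nβ j (u s)) (q₁ j) μ ≤ ENNReal.ofReal (2 * δ) := by
    refine (eLpNorm'_const_smul_le (hq₁' j)).trans ?_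
    rw [Real.enorm_of_nonneg (by positivity), show 2 * δ = δ / lam * (2 * lam) by field_simp,
      ENNReal.ofReal_mul (p := δ / lam) (by positivity)]
    gcongr
    exact eLpNorm'_restrict_activeSet_le hq₁' hq₂ hX j
  have h2 : eLpNorm' (fun s => nβ j (w s)) (q₁ j) μ ≤ ENNReal.ofReal δ :=
    (eLpNorm'_mono_measure _ hμle (hq₁' j).le).trans
      ((eLpNorm'_le_XNorm_left (fun j => (hq₁' j).le) hq₂ T w j).trans hw)
  calc _ ≤ eLpNorm' ((δ / lam) • fun s => nβ j (u s)) (q₁ j) μ +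
        eLpNorm' (fun s => nβ j (w s)) (q₁ j) μ :=
        eLpNorm'_add_le ((huβ j).const_smul (δ / lam)).aestronglyMeasurable
          (hwβ j).aestronglyMeasurable (hq₁ j)
    _ ≤ ENNReal.ofReal (2 * δ) + ENNReal.ofReal δ := add_le_add h1 h2
    _ = ENNReal.ofReal (3 * δ) := by
        rw [← ENNReal.ofReal_add (by positivity) hδ]
        ring_nf

end XNorm

theorem criticalGrowth_mul_add {α : Type*} {m : ℕ} (L c : ℝ) (σ : Fin m → ℝ)
    (Φ B B' : Fin m → α → ℝ) (s : α) :
    criticalGrowth L σ Φ (fun j s => c * B j s + B' j s) s =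
      c * criticalGrowth L σ Φ B s + criticalGrowth L σ Φ B' s := by
  simp only [criticalGrowth, Finset.mul_sum, ← Finset.sum_add_distrib]
  exact Finset.sum_congr rfl fun j _ => by ring

theorem weighted_sum_le_criticalGrowth {m : ℕ} {L : ℝ} (hL : 0 ≤ L) {ρ σ : Fin m → ℝ}
    (hρ : ∀ j, 0 ≤ ρ j) (hρσ : ∀ j, ρ j ≤ σ j) {α : Type*} {Φ Ψ B : Fin m → α → ℝ}
    (hΦ : ∀ j s, 0 ≤ Φ j s) (hΨ : ∀ j s, 0 ≤ Ψ j s) (hB : ∀ j s, 0 ≤ B j s) (s : α) :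
    L * ∑ j, (1 + Φ j s ^ ρ j + Ψ j s ^ ρ j) * B j s ≤
      criticalGrowth L σ Φ B s + criticalGrowth L σ Ψ B s := by
  rw [criticalGrowth, criticalGrowth, ← mul_add, ← Finset.sum_add_distrib]
  refine mul_le_mul_of_nonneg_left (Finset.sum_le_sum fun j _ => ?_) hL
  rw [← add_mul]
  refine mul_le_mul_of_nonneg_right ?_ (hB j s)
  linarith [rpow_le_one_add_rpow (hΦ j s) (hρ j) (hρσ j),
    rpow_le_one_add_rpow (hΨ j s) (hρ j) (hρσ j)]

theorem weighted_sum_zero_le_criticalGrowth {m : ℕ} {L : ℝ} (hL : 0 ≤ L) {ρ σ : Fin m → ℝ}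
    (hρ : ∀ j, 0 ≤ ρ j) (hρσ : ∀ j, ρ j ≤ σ j) {α : Type*} {Φ B : Fin m → α → ℝ}
    (hΦ : ∀ j s, 0 ≤ Φ j s) (hB : ∀ j s, 0 ≤ B j s) (s : α) :
    L * ∑ j, (1 + Φ j s ^ ρ j + 0 ^ ρ j) * B j s ≤ criticalGrowth L σ Φ B s := by
  refine mul_le_mul_of_nonneg_left (Finset.sum_le_sum fun j _ => ?_) hL
  refine mul_le_mul_of_nonneg_right ?_ (hB j s)
  linarith [rpow_le_one_add_rpow (hΦ j s) (hρ j) (hρσ j),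
    Real.rpow_le_one le_rfl zero_le_one (hρ j)]

theorem critical_exponent_relations {p κ φ β ρ σ r r' q₁ q₂ : ℝ} (hp : 2 < p) (hκ : 0 ≤ κ)
    (hφ : 1 - (1 + κ) / p < φ ∧ φ < 1) (hβ : 1 - (1 + κ) / p < β ∧ β ≤ φ)
    (hcrit : ρ * (φ - 1 + (1 + κ) / p) + β ≤ 1) (hσ : σ = (1 - β) / (φ - 1 + (1 + κ) / p))
    (hr : 1 / r = (β - 1 + (1 + κ) / p) / ((1 + κ) / p))
    (hr' : 1 / r' = σ * (φ - 1 + (1 + κ) / p) / ((1 + κ) / p))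
    (hq₁ : q₁ = p * r) (hq₂ : q₂ = σ * p * r') :
    0 < σ ∧ ρ ≤ σ ∧ p < q₁ ∧ p < q₂ ∧ 1 / p = σ / q₂ + 1 / q₁ ∧
      (1 + κ) * (1 / p - 1 / q₁) = 1 - β := by
  have hp0 : 0 < p := by linarith
  have hκ0 : 0 < 1 + κ := by linarith
  have ha : 0 < (1 + κ) / p := by positivity
  have hd : 0 < φ - 1 + (1 + κ) / p := by linarith
  have hb : 0 < β - 1 + (1 + κ) / p := by linarith
  have hβ1 : 0 < 1 - β := by linarith
  have hr_eq : r = (1 + κ) / p / (β - 1 + (1 + κ) / p) := by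
    rw [← one_div_one_div r, hr, one_div_div]
  have hσd : σ * (φ - 1 + (1 + κ) / p) = 1 - β := by
    rw [hσ, div_mul_cancel₀ _ hd.ne']
  have hr'_eq : r' = (1 + κ) / p / (1 - β) := by
    rw [← one_div_one_div r', hr', one_div_div, hσd]
  have hq₁_eq : q₁ = (1 + κ) / (β - 1 + (1 + κ) / p) := by
    rw [hq₁, hr_eq, ← mul_div_assoc, mul_div_cancel₀ _ hp0.ne']
  have hq₂_eq : q₂ = (1 + κ) / (φ - 1 + (1 + κ) / p) := by
    rw [hq₂, hr'_eq, hσ]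
    generalize φ - 1 + (1 + κ) / p = d at hd
    field_simp
  have hp_eq : p = (1 + κ) / ((1 + κ) / p) := by rw [div_div_cancel₀ hκ0.ne']
  have hinv₁ : 1 / q₁ = (β - 1 + (1 + κ) / p) / (1 + κ) := by rw [hq₁_eq, one_div_div]
  have hinv₂ : σ / q₂ = (1 - β) / (1 + κ) := by
    rw [hq₂_eq, div_div_eq_mul_div, hσd]
  refine ⟨?_, ?_, ?_, ?_, ?_, ?_⟩
  · rw [hσ]
    positivity
  · rw [hσ, le_div_iff₀ hd]
    linarith
  · rw [hq₁_eq]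
    nth_rw 1 [hp_eq]
    exact div_lt_div_of_pos_left hκ0 hb (by linarith)
  · rw [hq₂_eq]
    nth_rw 1 [hp_eq]
    exact div_lt_div_of_pos_left hκ0 hd (by linarith)
  · rw [hinv₁, hinv₂]
    field_simp
    ring
  · rw [hinv₁]
    field_simp
    ring

theorem exists_forall_sum_rpow_lt {m : ℕ} {a b : Fin m → ℝ} (ha : ∀ j, 0 < a j)
    (hb : ∀ j, 0 < b j) (L : ℝ) {ε : ℝ} (hε : 0 < ε) :
    ∃ δ > 0, ∀ s t : ℝ, 0 < s → s < δ → 0 < t → t < δ →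
      L * ∑ j, (3 * t ^ a j + (2 * s) ^ b j) < ε := by
  let f : ℝ × ℝ → ℝ := fun z => L * ∑ j, (3 * z.2 ^ a j + (2 * z.1) ^ b j)
  have hf : Continuous f := by
    refine continuous_const.mul (continuous_finsetSum _ fun j _ => ?_)
    exact (continuous_const.mul (continuous_snd.rpow_const fun _ => .inr (ha j).le)).add
      ((continuous_const.mul continuous_fst).rpow_const fun _ => .inr (hb j).le)
  have hf0 : f (0, 0) = 0 := by
    simp [f, Real.zero_rpow (ha _).ne', Real.zero_rpow (hb _).ne']
  obtain ⟨δ, hδ, h⟩ := Metric.continuousAt_iff.1 (hf.continuousAt (x := (0, 0))) ε hε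
  refine ⟨δ, hδ, fun s t hs hsδ ht htδ => ?_⟩
  have := h (x := (s, t)) (by
    rw [Prod.dist_eq, max_lt_iff]
    simp [abs_of_pos, hs, ht, hsδ, htδ])
  rw [hf0, dist_zero_right] at this
  exact (le_abs_self _).trans_lt this

/-- (Lemma 4.12 of the paper.) The truncated critical nonlinearity
`F_{c,λ}(x,u)(t) = Θ_λ(t,x,u) (F(t,u(t)) - F(t,0))` is bounded by `C_λ` in
`L^p((0,T),w_κ;X₀)`, and Lipschitz with constant `L_{λ,T}` with respect to
`‖u-v‖_{𝔛(T)} + sup_{[0,T]}‖u-v‖_Tr`; moreover `L_{λ,T} < ε` for all sufficiently small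
`T` and `λ`. -/
theorem stmt_10
    (p κ : ℝ) (hp : 2 < p) (hκ₀ : 0 ≤ κ) (hκ₁ : κ < p / 2 - 1)
    (m : ℕ) (hm : 1 ≤ m)
    (φ β ρ ρs r r' q₁ q₂ : Fin m → ℝ)
    (hφ : ∀ j, 1 - (1 + κ) / p < φ j ∧ φ j < 1)
    (hβ : ∀ j, 1 - (1 + κ) / p < β j ∧ β j ≤ φ j)
    (hρ : ∀ j, 0 ≤ ρ j)
    (hcrit : ∀ j, ρ j * (φ j - 1 + (1 + κ) / p) + β j ≤ 1)
    (hρs : ∀ j, ρs j = (1 - β j) / (φ j - 1 + (1 + κ) / p))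
    (hr : ∀ j, 1 / r j = (β j - 1 + (1 + κ) / p) / ((1 + κ) / p))
    (hr' : ∀ j, 1 / r' j = ρs j * (φ j - 1 + (1 + κ) / p) / ((1 + κ) / p))
    (hq₁ : ∀ j, q₁ j = p * r j) (hq₂ : ∀ j, q₂ j = ρs j * p * r' j)
    (V : Type*) [AddCommGroup V] [Module ℝ V]
    (nβ nφ : Fin m → Seminorm ℝ V) (nTr : Seminorm ℝ V)
    (T N : ℝ) (hT : 0 < T) (hN : 1 ≤ N)
    (X₀ : Type*) [NormedAddCommGroup X₀] [NormedSpace ℝ X₀]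
    (F : ℝ → V → X₀) (L : ℝ) (hL : 0 < L)
    (hF : ∀ t ∈ Icc (0 : ℝ) T, ∀ x y : V, nTr x ≤ N + 2 → nTr y ≤ N + 2 →
      ‖F t x - F t y‖ ≤
        L * ∑ j : Fin m, (1 + nφ j x ^ ρ j + nφ j y ^ ρ j) * nβ j (x - y)) :
    ∃ (C : ℝ → ℝ) (Lc : ℝ → ℝ → ℝ),
      (∀ lam T' : ℝ, 0 < lam → lam < 1 → 0 < T' → T' ≤ T →
        ∀ x : V, nTr x ≤ N →
        ∀ u v : ℝ → V,
          (∀ s₀ ∈ Icc (0 : ℝ) T', Filter.Tendsto (fun s => nTr (u s - u s₀))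
            (nhdsWithin s₀ (Icc (0 : ℝ) T')) (nhds 0)) →
          (∀ s₀ ∈ Icc (0 : ℝ) T', Filter.Tendsto (fun s => nTr (v s - v s₀))
            (nhdsWithin s₀ (Icc (0 : ℝ) T')) (nhds 0)) →
          XNorm κ m q₁ q₂ nβ nφ T' u < ⊤ →
          XNorm κ m q₁ q₂ nβ nφ T' v < ⊤ →
          (∀ j, Measurable fun s => nβ j (u s)) →
          (∀ j, Measurable fun s => nφ j (u s)) →
          (∀ j, Measurable fun s => nβ j (v s)) →
          (∀ j, Measurable fun s => nφ j (v s)) →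
          (∀ j, Measurable fun s => nβ j (u s - v s)) →
          (∀ j, Measurable fun s => nφ j (u s - v s)) →
          AEStronglyMeasurable (fun t => F t (u t) - F t 0)
            (volume.restrict (Ioo 0 T')) →
          AEStronglyMeasurable (fun t => F t (v t) - F t 0)
            (volume.restrict (Ioo 0 T')) →
          (∫⁻ t in Ioo (0 : ℝ) T',
              ENNReal.ofReal
                (‖Theta κ m q₁ q₂ nβ nφ nTr lam t x u • (F t (u t) - F t 0)‖ ^ p * t ^ κ)) ^
                (1 / p) ≤
            ENNReal.ofReal (C lam) ∧
          (∫⁻ t in Ioo (0 : ℝ) T',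
              ENNReal.ofReal
                (‖Theta κ m q₁ q₂ nβ nφ nTr lam t x u • (F t (u t) - F t 0) -
                    Theta κ m q₁ q₂ nβ nφ nTr lam t x v • (F t (v t) - F t 0)‖ ^ p * t ^ κ)) ^
                (1 / p) ≤
            ENNReal.ofReal (Lc lam T') *
              (XNorm κ m q₁ q₂ nβ nφ T' (u - v) +
                ENNReal.ofReal (sSup ((fun s => nTr (u s - v s)) '' Icc 0 T')))) ∧
      ∀ ε : ℝ, 0 < ε → ∃ Tb lb : ℝ, 0 < Tb ∧ 0 < lb ∧
        ∀ lam T' : ℝ, 0 < lam → lam < lb → lam < 1 → 0 < T' → T' < Tb → T' ≤ T →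
          Lc lam T' < ε := by
  have hp0 : 0 < p := by linarith
  have hp1 : 1 ≤ p := by linarith
  have hex := fun j => critical_exponent_relations hp hκ₀ (hφ j) (hβ j) (hcrit j) (hρs j)
    (hr j) (hr' j) (hq₁ j) (hq₂ j)
  choose hσ hρσ hpq₁ hpq₂ hpq hexp using hex
  have hq₁1 : ∀ j, 1 ≤ q₁ j := fun j => hp1.trans (hpq₁ j).le
  have hq₂1 : ∀ j, 1 ≤ q₂ j := fun j => hp1.trans (hpq₂ j).le
  have hq₁0 : ∀ j, 0 < q₁ j := fun j => zero_lt_one.trans_le (hq₁1 j)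
  have hq₂0 : ∀ j, 0 < q₂ j := fun j => zero_lt_one.trans_le (hq₂1 j)
  have hq₁nn : ∀ j, 0 ≤ q₁ j := fun j => (hq₁0 j).le
  have hq₂nn : ∀ j, 0 ≤ q₂ j := fun j => (hq₂0 j).le
  have hβ1 : ∀ j, 0 < 1 - β j := fun j => by linarith [(hφ j).2, (hβ j).2]
  let K : ℝ → ℝ → ℝ := fun lam T' => L * ∑ j, (3 * T' ^ (1 - β j) + (2 * lam) ^ ρs j)
  refine ⟨fun lam => K lam T * (2 * lam), fun lam T' => 6 * K lam T', ?_, ?_⟩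
  · intro lam T' hlam hlam1 hT' hT'T x hx u v hu hv hXu hXv huβ huφ hvβ hvφ hwβ hwφ _ _
    have hK : 0 ≤ K lam T' := mul_nonneg hL.le (Finset.sum_nonneg fun j _ => by positivity)
    have hKT : K lam T' ≤ K lam T := by
      refine mul_le_mul_of_nonneg_left (Finset.sum_le_sum fun j _ => ?_) hL.le
      have := Real.rpow_le_rpow hT'.le hT'T (hβ1 j).le
      linarith
    have hub := bddAbove_seminorm_sub_image isCompact_Icc hu x
    have hvb := bddAbove_seminorm_sub_image isCompact_Icc hv x
    have hF0 : ∀ (f : ℝ → V), BddAbove ((fun s => nTr (f s - x)) '' Icc 0 T') →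
        ∀ t ∈ activeSet κ m q₁ q₂ nβ nφ nTr x f lam T', ‖F t (f t) - F t 0‖ ≤
          criticalGrowth L ρs (fun j s => nφ j (f s)) (fun j s => nβ j (f s)) t := by
      intro f hfb t ht
      have h := hF t ⟨ht.1.1.le, ht.1.2.le.trans hT'T⟩ (f t) 0
        (seminorm_le_of_mem_activeSet hfb hlam1 hx ht) (by rw [map_zero]; linarith)
      simp only [map_zero, sub_zero] at h
      exact h.trans (weighted_sum_zero_le_criticalGrowth hL.le hρ hρσ
        (Φ := fun j s => nφ j (f s)) (B := fun j s => nβ j (f s))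
        (fun _ _ => apply_nonneg _ _) (fun _ _ => apply_nonneg _ _) t)
    constructor
    · refine (lintegral_weight_rpow_eq_eLpNorm' κ hp0.le measurableSet_Ioo _).trans_le ?_
      refine (eLpNorm'_mono_ae hp0.le (ae_restrict_of_forall_mem measurableSet_Ioo
        fun t ht => ?_)).trans ((eLpNorm'_indicator_activeSet_criticalGrowth_le hκ₀ hT' hlam hL.le
          hp1 hσ hq₁nn hq₂0 hpq₁ hpq hexp hXu hub huφ huβ
          (eLpNorm'_restrict_activeSet_le hq₁0 hq₂nn hXu)).trans ?_)
      · refine (norm_xiCut_smul_le hlam _).trans ?_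
        split_ifs with ha
        · have htS : t ∈ activeSet κ m q₁ q₂ nβ nφ nTr x u lam T' := ⟨ht, ha⟩
          rw [indicator_of_mem htS]
          exact (hF0 u hub t htS).trans (le_abs_self _)
        · exact norm_nonneg _
      · rw [← ENNReal.ofReal_mul hK]
        exact ENNReal.ofReal_le_ofReal (mul_le_mul_of_nonneg_right hKT (by positivity))
    · have hXw : XNorm κ m q₁ q₂ nβ nφ T' (u - v) < ⊤ := by
        refine (XNorm_le_add hq₁1 hq₂1 (fun j s => map_sub_le_add (nβ j) (u s) (v s))
          (fun j s => map_sub_le_add (nφ j) (u s) (v s)) huβ huφ hvβ hvφ T').trans_lt ?_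
        exact ENNReal.add_lt_top.2 ⟨hXu, hXv⟩
      have hwb : BddAbove ((fun s => nTr ((u - v) s)) '' Icc 0 T') := by
        obtain ⟨a, ha⟩ := hub
        obtain ⟨b, hb⟩ := hvb
        refine ⟨a + b, ?_⟩
        rintro _ ⟨s, hs, rfl⟩
        have h := map_sub_le_add nTr (u s - x) (v s - x)
        rw [sub_sub_sub_cancel_right] at h
        exact h.trans (add_le_add (ha (mem_image_of_mem _ hs)) (hb (mem_image_of_mem _ hs)))
      have hsup := sSup_seminorm_image_nonneg (nTr := nTr) (u - v) (Icc 0 T')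
      set δ : ℝ := (XNorm κ m q₁ q₂ nβ nφ T' (u - v)).toReal +
        sSup ((fun s => nTr ((u - v) s)) '' Icc 0 T') with hδ_def
      have hδ : 0 ≤ δ := add_nonneg ENNReal.toReal_nonneg hsup
      have hδ_eq : XNorm κ m q₁ q₂ nβ nφ T' (u - v) +
          ENNReal.ofReal (sSup ((fun s => nTr (u s - v s)) '' Icc 0 T')) = ENNReal.ofReal δ := by
        rw [hδ_def, ENNReal.ofReal_add ENNReal.toReal_nonneg hsup,
          ENNReal.ofReal_toReal hXw.ne]
        rfl
      have hXwδ : XNorm κ m q₁ q₂ nβ nφ T' (u - v) ≤ ENNReal.ofReal δ := by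
        rw [← hδ_eq]
        exact le_self_add
      have hu_le : ∀ (n : Seminorm ℝ V) (y z w : V), n (y - w) ≤ n (z - w) + n (y - z) :=
        fun n y z w => by simpa using map_add_le_add n (z - w) (y - z)
      have hv_le : ∀ (n : Seminorm ℝ V) (y z w : V), n (z - w) ≤ n (y - w) + n (y - z) :=
        fun n y z w => by simpa using map_sub_le_add n (y - w) (y - z)
      have hu_le0 : ∀ (n : Seminorm ℝ V) (y z : V), n y ≤ n z + n (y - z) :=
        fun n y z => by simpa using hu_le n y z 0
      have hv_le0 : ∀ (n : Seminorm ℝ V) (y z : V), n z ≤ n y + n (y - z) :=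
        fun n y z => by simpa using hv_le n y z 0
      have harg : ∀ t ∈ Ioo 0 T', |truncArg κ m q₁ q₂ nβ nφ nTr x u t -
          truncArg κ m q₁ q₂ nβ nφ nTr x v t| ≤ δ := by
        intro t ht
        have h1 := truncArg_le_add hq₁1 hq₂1 ht.1.le ht.2.le (u := u) (v := v) (w := u - v)
          (fun j s => hu_le0 (nβ j) (u s) (v s)) (fun j s => hu_le0 (nφ j) (u s) (v s))
          (fun s => hu_le nTr (u s) (v s) x) hvβ hvφ hwβ hwφ hXv hXw hvb hwb
        have h2 := truncArg_le_add hq₁1 hq₂1 ht.1.le ht.2.le (u := v) (v := u) (w := u - v)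
          (fun j s => hv_le0 (nβ j) (u s) (v s)) (fun j s => hv_le0 (nφ j) (u s) (v s))
          (fun s => hv_le nTr (u s) (v s) x) huβ huφ hwβ hwφ hXu hXw hub hwb
        exact abs_sub_le_iff.2 ⟨sub_le_iff_le_add'.2 h1, sub_le_iff_le_add'.2 h2⟩
      let g : (ℝ → V) → ℝ → ℝ := fun f => criticalGrowth L ρs (fun j s => nφ j (f s))
        fun j s => δ / lam * nβ j (f s) + nβ j ((u - v) s)
      have hmeas : ∀ f : ℝ → V, (∀ j, Measurable fun s => nβ j (f s)) → ∀ j,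
          Measurable fun s => δ / lam * nβ j (f s) + nβ j ((u - v) s) :=
        fun f hfβ j => ((hfβ j).const_mul _).add (hwβ j)
      have hg : ∀ f : ℝ → V, XNorm κ m q₁ q₂ nβ nφ T' f < ⊤ →
          BddAbove ((fun s => nTr (f s - x)) '' Icc 0 T') →
          (∀ j, Measurable fun s => nβ j (f s)) → (∀ j, Measurable fun s => nφ j (f s)) →
          AEStronglyMeasurable ((activeSet κ m q₁ q₂ nβ nφ nTr x f lam T').indicator (g f))
              ((powWeight κ).restrict (Ioo 0 T')) ∧
            eLpNorm' ((activeSet κ m q₁ q₂ nβ nφ nTr x f lam T').indicator (g f)) p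
              ((powWeight κ).restrict (Ioo 0 T')) ≤ ENNReal.ofReal (3 * K lam T' * δ) := by
        intro f hXf hfb hfβ hfφ
        refine ⟨((measurable_criticalGrowth L ρs hfφ (hmeas f hfβ)).indicator
          (measurableSet_activeSet hq₁nn hq₂nn hXf hfb)).aestronglyMeasurable, ?_⟩
        refine (eLpNorm'_indicator_activeSet_criticalGrowth_le hκ₀ hT' hlam hL.le
          hp1 hσ hq₁nn hq₂0 hpq₁ hpq hexp hXf hfb hfφ (hmeas f hfβ)
          (eLpNorm'_restrict_activeSet_add_le hlam hδ hq₁1 hq₂nn hXf hXwδ hfβ hwβ)).trans_eq ?_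
        rw [← ENNReal.ofReal_mul hK]
        congr 1
        ring
      have hgu := hg u hXu hub huβ huφ
      have hgv := hg v hXv hvb hvβ hvφ
      rw [hδ_eq]
      refine (lintegral_weight_rpow_eq_eLpNorm' κ hp0.le measurableSet_Ioo _).trans_le ?_
      calc _ ≤ eLpNorm' ((activeSet κ m q₁ q₂ nβ nφ nTr x u lam T').indicator (g u) +
              (activeSet κ m q₁ q₂ nβ nφ nTr x v lam T').indicator (g v)) p
              ((powWeight κ).restrict (Ioo 0 T')) := by
            refine eLpNorm'_mono_ae hp0.le (ae_restrict_of_forall_mem measurableSet_Ioo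
              fun t ht => (le_abs_self _).trans' ?_)
            refine (norm_xiCut_smul_sub_le hlam (harg t ht) _ _).trans ?_
            have hmem : ∀ f : ℝ → V, t ∈ activeSet κ m q₁ q₂ nβ nφ nTr x f lam T' ↔
                truncArg κ m q₁ q₂ nβ nφ nTr x f t < 2 * lam := fun f => and_iff_right ht
            have hw0 : ∀ f : ℝ → V, 0 ≤ criticalGrowth L ρs (fun j s => nφ j (f s))
                (fun j s => nβ j ((u - v) s)) t := fun f =>
              criticalGrowth_nonneg hL.le (fun _ _ => apply_nonneg _ _)
                (fun _ _ => apply_nonneg _ _) t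
            have hself : ∀ f : ℝ → V, BddAbove ((fun s => nTr (f s - x)) '' Icc 0 T') →
                truncArg κ m q₁ q₂ nβ nφ nTr x f t < 2 * lam →
                δ / lam * ‖F t (f t) - F t 0‖ + criticalGrowth L ρs (fun j s => nφ j (f s))
                  (fun j s => nβ j ((u - v) s)) t ≤ g f t := by
              intro f hfb hf
              refine le_of_le_of_eq ?_ (criticalGrowth_mul_add L (δ / lam) ρs
                (fun j s => nφ j (f s)) (fun j s => nβ j (f s))
                (fun j s => nβ j ((u - v) s)) t).symm
              gcongr
              exact hF0 f hfb t ((hmem f).2 hf)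
            have hdiff : truncArg κ m q₁ q₂ nβ nφ nTr x u t < 2 * lam →
                truncArg κ m q₁ q₂ nβ nφ nTr x v t < 2 * lam →
                ‖F t (u t) - F t 0 - (F t (v t) - F t 0)‖ ≤
                  criticalGrowth L ρs (fun j s => nφ j (u s)) (fun j s => nβ j ((u - v) s)) t +
                  criticalGrowth L ρs (fun j s => nφ j (v s)) (fun j s => nβ j ((u - v) s)) t := by
              intro htu htv
              rw [sub_sub_sub_cancel_right]
              exact (hF t ⟨ht.1.le, ht.2.le.trans hT'T⟩ (u t) (v t)
                (seminorm_le_of_mem_activeSet hub hlam1 hx ((hmem u).2 htu))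
                (seminorm_le_of_mem_activeSet hvb hlam1 hx ((hmem v).2 htv))).trans
                (weighted_sum_le_criticalGrowth hL.le hρ hρσ
                  (Φ := fun j s => nφ j (u s)) (Ψ := fun j s => nφ j (v s))
                  (B := fun j s => nβ j ((u - v) s)) (fun _ _ => apply_nonneg _ _)
                  (fun _ _ => apply_nonneg _ _) (fun _ _ => apply_nonneg _ _) t)
            have hind : ∀ f : ℝ → V,
                (activeSet κ m q₁ q₂ nβ nφ nTr x f lam T').indicator (g f) t =
                  if truncArg κ m q₁ q₂ nβ nφ nTr x f t < 2 * lam then g f t else 0 := by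
              intro f
              split_ifs with hf
              · exact indicator_of_mem ((hmem f).2 hf) _
              · exact indicator_of_notMem (fun h => hf ((hmem f).1 h)) _
            rw [Pi.add_apply, hind u, hind v]
            change (if truncArg κ m q₁ q₂ nβ nφ nTr x u t < 2 * lam then _ else _) +
              (if truncArg κ m q₁ q₂ nβ nφ nTr x v t < 2 * lam then _ else _) +
              (if truncArg κ m q₁ q₂ nβ nφ nTr x u t < 2 * lam ∧
                truncArg κ m q₁ q₂ nβ nφ nTr x v t < 2 * lam then _ else _) ≤ _
            by_cases htu : truncArg κ m q₁ q₂ nβ nφ nTr x u t < 2 * lam <;>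
              by_cases htv : truncArg κ m q₁ q₂ nβ nφ nTr x v t < 2 * lam <;>
              simp only [htu, htv, if_true, if_false, and_true, and_false, add_zero, zero_add,
                le_refl]
            · linarith [hself u hub htu, hself v hvb htv, hdiff htu htv]
            · linarith [hself u hub htu, hw0 u]
            · linarith [hself v hvb htv, hw0 v]
        _ ≤ ENNReal.ofReal (3 * K lam T' * δ) + ENNReal.ofReal (3 * K lam T' * δ) :=
            (eLpNorm'_add_le hgu.1 hgv.1 hp1).trans (add_le_add hgu.2 hgv.2)
        _ = ENNReal.ofReal (6 * K lam T') * ENNReal.ofReal δ := by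
            rw [← ENNReal.ofReal_add (by positivity) (by positivity),
              ← ENNReal.ofReal_mul (by positivity)]
            ring_nf
  · intro ε hε
    obtain ⟨δ, hδ, h⟩ := exists_forall_sum_rpow_lt hβ1 hσ L (show 0 < ε / 6 by positivity)
    refine ⟨δ, δ, hδ, hδ, fun lam T' hlam hlamδ _ hT' hT'δ _ => ?_⟩
    have := h lam T' hlam hlamδ hT' hT'δ
    change 6 * (L * _) < ε
    linarith
end
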